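/- The fourth basic cohomology of the Schrödinger-Virasoro conformal algebra with trivial coefficients vanishes: H̃⁴(SV,ℂ) = 0, i.e., every 4-cocycle is a 4-coboundary. -/

import Mathlib

/-!
Cochain complex of the Schrödinger–Virasoro conformal algebra
`SV = ℂ[∂]L ⊕ ℂ[∂]Y ⊕ ℂ[∂]M` with coefficients in the trivial module `ℂ_a`.

Since `SV` is a free `ℂ[∂]`-module on the generators `L, Y, M`, and since a
`q`-cochain (a `ℂ`-linear, conformally antilinear map `SV^{⊗q} → ℂ[λ₁,…,λ_q]`)
is uniquely determined by its values on `q`-tuples of generators, we model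
cochains as functions from generator tuples to `ℂ[λ₁,…,λ_q]`, subject to the
skew-symmetry condition (simultaneous permutation of the entries and the
variables `λᵢ`).
-/

namespace SVCA

open MvPolynomial

/-- The generators `L`, `Y`, `M` of the Schrödinger–Virasoro conformal algebra. -/
inductive SVGen : Type
  | L | Y | M
  deriving DecidableEq

open SVGen

/-- The λ-brackets on generators: `SVbrk a b = (x, c₁, c₂)` encodes
`[a_λ b] = (c₁ ∂ + c₂ λ) x`.  Zero brackets are encoded by zero coefficients:
`[L_λ L] = (∂+2λ)L`, `[L_λ Y] = (∂+(3/2)λ)Y`, `[Y_λ L] = ((1/2)∂+(3/2)λ)Y`,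
`[Y_λ Y] = (∂+2λ)M`, `[L_λ M] = (∂+λ)M`, `[M_λ L] = λM`, and
`[Y_λ M] = [M_λ Y] = [M_λ M] = 0`. -/
noncomputable def SVbrk : SVGen → SVGen → SVGen × ℂ × ℂ
  | L, L => (L, 1, 2)
  | L, Y => (Y, 1, 3/2)
  | Y, L => (Y, 1/2, 3/2)
  | Y, Y => (M, 1, 2)
  | L, M => (M, 1, 1)
  | M, L => (M, 0, 1)
  | _, _ => (M, 0, 0)

/-- The space of (not necessarily skew-symmetric) `q`-cochains with trivial
coefficients: functions from `q`-tuples of generators to `ℂ[λ₁,…,λ_q]`. -/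
abbrev SVRaw (q : ℕ) := (Fin q → SVGen) → MvPolynomial (Fin q) ℂ

/-- The `ℂ`-subspace `C̃^q(SV,ℂ)` of `q`-cochains: skew-symmetry with respect to
simultaneous permutations of the arguments and of the variables `λᵢ`. -/
noncomputable def SVCochain (q : ℕ) : Submodule ℂ (SVRaw q) where
  carrier := {c | ∀ (σ : Equiv.Perm (Fin q)) (a : Fin q → SVGen),
      rename σ (c (a ∘ σ)) = ((Equiv.Perm.sign σ : ℤ) : ℂ) • c a}
  add_mem' := by
    intro c c' hc hc' σ a
    simp only [Pi.add_apply, map_add, hc σ a, hc' σ a, smul_add]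
  zero_mem' := by intro σ a; simp
  smul_mem' := by
    intro r c hc σ a
    simp only [Pi.smul_apply, map_smul, hc σ a]
    rw [smul_comm]

/-- The strictly increasing embedding `Fin q → Fin (q+2)` omitting `i` and `j`
(meaningful for `i < j`; junk otherwise). -/
def SVskip {q : ℕ} (i j : Fin (q + 2)) (k : Fin q) : Fin (q + 2) :=
  j.succAbove ((⟨min (i : ℕ) q, Nat.lt_succ_of_le (Nat.min_le_right _ _)⟩ : Fin (q + 1)).succAbove k)

/-- The `(i,j)`-summand of the differential (trivial coefficients):
`(-1)^{i+j} γ_{λᵢ+λⱼ, λ₁, …, λ̂ᵢ, …, λ̂ⱼ, …}([a_{i λᵢ} a_j], a₁, …, âᵢ, …, âⱼ, …)`,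
where `[a_{i λᵢ} a_j] = (c₁∂ + c₂λᵢ)x` and conformal antilinearity in the first
slot (whose variable is `λᵢ+λⱼ`) produces the factor `c₂λᵢ - c₁(λᵢ+λⱼ)`. -/
noncomputable def SVdTerm {q : ℕ} (c : SVRaw (q + 1)) (a : Fin (q + 2) → SVGen)
    (i j : Fin (q + 2)) : MvPolynomial (Fin (q + 2)) ℂ :=
  ((-1 : ℂ) ^ ((i : ℕ) + (j : ℕ))) •
    ((C (SVbrk (a i) (a j)).2.2 * X i - C (SVbrk (a i) (a j)).2.1 * (X i + X j)) *
      aeval (Fin.cons (X i + X j) fun k => X (SVskip i j k))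
        (c (Fin.cons (SVbrk (a i) (a j)).1 fun k => a (SVskip i j k))))

/-- The differential `d_q : C̃^q → C̃^{q+1}` (trivial coefficients). -/
noncomputable def SVd : {q : ℕ} → SVRaw q → SVRaw (q + 1)
  | 0, _ => 0
  | (q + 1), c => fun a =>
      ∑ i : Fin (q + 2), ∑ j : Fin (q + 2),
        if (i : ℕ) < (j : ℕ) then SVdTerm c a i j else 0

lemma SVdTerm_add {q : ℕ} (c c' : SVRaw (q + 1)) (a : Fin (q + 2) → SVGen)
    (i j : Fin (q + 2)) :
    SVdTerm (c + c') a i j = SVdTerm c a i j + SVdTerm c' a i j := by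
  simp [SVdTerm, mul_add, smul_add]

lemma SVdTerm_smul {q : ℕ} (r : ℂ) (c : SVRaw (q + 1)) (a : Fin (q + 2) → SVGen)
    (i j : Fin (q + 2)) :
    SVdTerm (r • c) a i j = r • SVdTerm c a i j := by
  simp only [SVdTerm, Pi.smul_apply, map_smul, mul_smul_comm]
  rw [smul_comm]

/-- The differential as a `ℂ`-linear map. -/
noncomputable def SVdLin (q : ℕ) : SVRaw q →ₗ[ℂ] SVRaw (q + 1) where
  toFun := SVd
  map_add' c c' := by
    cases q with
    | zero => simp [SVd]
    | succ q =>
      funext a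
      simp only [SVd, Pi.add_apply]
      rw [← Finset.sum_add_distrib]
      refine Finset.sum_congr rfl fun i _ => ?_
      rw [← Finset.sum_add_distrib]
      refine Finset.sum_congr rfl fun j _ => ?_
      by_cases h : (i : ℕ) < (j : ℕ)
      · simp [h, SVdTerm_add]
      · simp [h]
  map_smul' r c := by
    cases q with
    | zero => simp [SVd]
    | succ q =>
      funext a
      simp only [SVd, RingHom.id_apply, Pi.smul_apply, Finset.smul_sum]
      refine Finset.sum_congr rfl fun i _ => ?_
      refine Finset.sum_congr rfl fun j _ => ?_
      by_cases h : (i : ℕ) < (j : ℕ)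
      · simp [h, SVdTerm_smul]
      · simp [h]

/-- The space `D̃^q(SV,ℂ)` of `q`-cocycles: skew-symmetric cochains with `dγ = 0`. -/
noncomputable def SVcocycles (q : ℕ) : Submodule ℂ (SVRaw q) :=
  SVCochain q ⊓ LinearMap.ker (SVdLin q)

/-- The space `B̃^q(SV,ℂ)` of `q`-coboundaries: differentials of `(q-1)`-cochains
(`0` for `q = 0`). -/
noncomputable def SVcoboundaries : (q : ℕ) → Submodule ℂ (SVRaw q)
  | 0 => ⊥
  | (q + 1) => Submodule.map (SVdLin q) (SVCochain q)

/-- The basic cohomology `H̃^q(SV,ℂ)` = cocycles / coboundaries. -/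
noncomputable def SVbasicH (q : ℕ) :=
  SVcocycles q ⧸ Submodule.comap (SVcocycles q).subtype (SVcoboundaries q)


noncomputable instance (q : ℕ) : AddCommGroup (SVbasicH q) := by
  unfold SVbasicH; infer_instance
noncomputable instance (q : ℕ) : Module ℂ (SVbasicH q) := by
  unfold SVbasicH; infer_instance

/-- The action of `∂` on `q`-cochains with coefficients in `ℂ_a`:
`(∂γ)_{λ₁,…,λ_q} = (a + λ₁ + ⋯ + λ_q)·γ_{λ₁,…,λ_q}`.  (The trivial module `ℂ`
is the case `a = 0`.) -/
noncomputable def SVpartial (a : ℂ) (q : ℕ) : SVRaw q →ₗ[ℂ] SVRaw q where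
  toFun c := fun t => (C a + ∑ i, X i) * c t
  map_add' c c' := by funext t; simp [mul_add]
  map_smul' r c := by funext t; simp [mul_smul_comm]

/-- The subspace `∂C̃^q ⊆ C̃^q` (with coefficients in `ℂ_a`). -/
noncomputable def SVpartialSub (a : ℂ) (q : ℕ) : Submodule ℂ (SVRaw q) :=
  Submodule.map (SVpartial a q) (SVCochain q)

/-- `q`-cochains representing reduced `q`-cocycles: cochains `γ` with
`dγ ∈ ∂C̃^{q+1}` (these are exactly the representatives of `ker d̄`
in the quotient complex `C̃^•/∂C̃^•`). -/
noncomputable def SVredCocycles (a : ℂ) (q : ℕ) : Submodule ℂ (SVRaw q) :=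
  SVCochain q ⊓ Submodule.comap (SVdLin q) (SVpartialSub a (q + 1))

/-- `q`-cochains representing reduced `q`-coboundaries: `∂C̃^q + dC̃^{q-1}`
(these are exactly the representatives of `im d̄` in the quotient complex). -/
noncomputable def SVredCoboundaries (a : ℂ) : (q : ℕ) → Submodule ℂ (SVRaw q)
  | 0 => SVpartialSub a 0
  | (q + 1) => SVpartialSub a (q + 1) ⊔ Submodule.map (SVdLin q) (SVCochain q)

/-- The reduced cohomology `H^q(SV,ℂ_a)`, realized (via the third isomorphism
theorem) as `{γ ∈ C̃^q : dγ ∈ ∂C̃^{q+1}} / (∂C̃^q + dC̃^{q-1})`. -/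
noncomputable def SVredH (a : ℂ) (q : ℕ) :=
  SVredCocycles a q ⧸ Submodule.comap (SVredCocycles a q).subtype (SVredCoboundaries a q)


noncomputable instance (a : ℂ) (q : ℕ) : AddCommGroup (SVredH a q) := by
  unfold SVredH; infer_instance
noncomputable instance (a : ℂ) (q : ℕ) : Module ℂ (SVredH a q) := by
  unfold SVredH; infer_instance

/-- The cocycles of the subcomplex `∂C̃^•` (trivial coefficients `ℂ`). -/
noncomputable def SVsubCocycles (q : ℕ) : Submodule ℂ (SVRaw q) :=
  SVpartialSub 0 q ⊓ LinearMap.ker (SVdLin q)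

/-- The coboundaries of the subcomplex `∂C̃^•` (trivial coefficients `ℂ`). -/
noncomputable def SVsubCoboundaries : (q : ℕ) → Submodule ℂ (SVRaw q)
  | 0 => ⊥
  | (q + 1) => Submodule.map (SVdLin q) (SVpartialSub 0 q)

/-- The cohomology `H^q(∂C̃^•)` of the subcomplex `∂C̃^•` (trivial coefficients). -/
noncomputable def SVsubH (q : ℕ) :=
  SVsubCocycles q ⧸ Submodule.comap (SVsubCocycles q).subtype (SVsubCoboundaries q)


noncomputable instance (q : ℕ) : AddCommGroup (SVsubH q) := by
  unfold SVsubH; infer_instance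
noncomputable instance (q : ℕ) : Module ℂ (SVsubH q) := by
  unfold SVsubH; infer_instance

/-- The operator `τ`:
`(τγ)_{λ₁,…,λ_{q-1}}(a₁,…,a_{q-1}) = (-1)^{q-1} ∂/∂λ γ_{λ₁,…,λ_{q-1},λ}(a₁,…,a_{q-1},L)|_{λ=0}`. -/
noncomputable def SVtau {q : ℕ} (c : SVRaw (q + 1)) : SVRaw q := fun a =>
  ((-1 : ℂ) ^ q) •
    aeval (Fin.snoc (fun i : Fin q => X i) 0)
      (pderiv (Fin.last q) (c (Fin.snoc a SVGen.L)))

/-- The operator `τ₂`: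
`(τ₂γ)_{λ₁,…,λ_{q-1}}(a₁,…,a_{q-1}) = (-1)^{q-1} γ_{λ₁,…,λ_{q-1},λ}(a₁,…,a_{q-1},L)|_{λ=0}`. -/
noncomputable def SVtau2 {q : ℕ} (c : SVRaw (q + 1)) : SVRaw q := fun a =>
  ((-1 : ℂ) ^ q) • aeval (Fin.snoc (fun i : Fin q => X i) 0) (c (Fin.snoc a SVGen.L))

/-- The tuple with `k` copies of `L`, then `l` copies of `Y`, then copies of `M`. -/
def SVtuple (q k l : ℕ) : Fin q → SVGen := fun i =>
  if (i : ℕ) < k then SVGen.L else if (i : ℕ) < k + l then SVGen.Y else SVGen.M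

/-- `∏_{i<j ∈ s} (λᵢ - λⱼ)`. -/
noncomputable def SVvandermonde (q : ℕ) (s : Finset (Fin q)) : MvPolynomial (Fin q) ℂ :=
  ∏ p ∈ (s ×ˢ s).filter fun p => p.1 < p.2, (X p.1 - X p.2)

/-- Conformal weights of the generators, doubled. -/
def SVwt : SVGen → ℤ
  | L => 2
  | Y => 1
  | M => 0

/-- The component of a cochain of (doubled) `L₀`-weight `n`. -/
noncomputable def SVproj {q : ℕ} (n : ℤ) (c : SVRaw q) : SVRaw q := fun a =>
  weightedHomogeneousComponent (fun _ => (2 : ℤ)) (n + ∑ i, SVwt (a i)) (c a)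

/-- A cochain of (doubled) `L₀`-weight `n`. -/
def SVHomog {q : ℕ} (n : ℤ) (c : SVRaw q) : Prop :=
  ∀ a, IsWeightedHomogeneous (fun _ => (2 : ℤ)) (c a) (n + ∑ i, SVwt (a i))

lemma SVproj_homog {q : ℕ} (n : ℤ) (c : SVRaw q) : SVHomog n (SVproj n c) := fun _ =>
  weightedHomogeneousComponent_isWeightedHomogeneous _ _

lemma weightedHomogeneousComponent_comm {σ τ : Type*} (w : σ → ℤ) (w' : τ → ℤ) (k : ℤ)
    (f : MvPolynomial σ ℂ →ₗ[ℂ] MvPolynomial τ ℂ)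
    (hf : ∀ m r, IsWeightedHomogeneous w' (f (monomial m r)) (Finsupp.weight w m + k))
    (n : ℤ) (p : MvPolynomial σ ℂ) :
    weightedHomogeneousComponent w' (n + k) (f p) = f (weightedHomogeneousComponent w n p) := by
  induction p using MvPolynomial.induction_on' with
  | monomial m r =>
    by_cases h : Finsupp.weight w m = n
    · rw [IsWeightedHomogeneous.weightedHomogeneousComponent_same
        (isWeightedHomogeneous_monomial w m r h)]
      exact IsWeightedHomogeneous.weightedHomogeneousComponent_same (h ▸ hf m r)
    · rw [IsWeightedHomogeneous.weightedHomogeneousComponent_ne n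
        (isWeightedHomogeneous_monomial w m r rfl) (Ne.symm h), map_zero]
      exact IsWeightedHomogeneous.weightedHomogeneousComponent_ne _ (hf m r)
        (by simpa using Ne.symm h)
  | add p q hp hq => simp only [map_add, hp, hq]

lemma isWeightedHomogeneous_aeval_monomial {σ τ : Type*} [Fintype σ]
    (g : σ → MvPolynomial τ ℂ)
    (hg : ∀ i, IsWeightedHomogeneous (fun _ => (2 : ℤ)) (g i) 2) (m : σ →₀ ℕ) (r : ℂ) :
    IsWeightedHomogeneous (fun _ => (2 : ℤ)) (aeval g (monomial m r))
      (Finsupp.weight (fun _ => (2 : ℤ)) m) := by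
  rw [aeval_monomial, Finsupp.weight_apply, Finsupp.sum, Finsupp.prod, algebraMap_eq]
  exact IsWeightedHomogeneous.C_mul
    (IsWeightedHomogeneous.prod _ _ _ fun i _ => (hg i).pow _) _

lemma SVproj_cochain {q : ℕ} (n : ℤ) {c : SVRaw q} (hc : c ∈ SVCochain q) :
    SVproj n c ∈ SVCochain q := by
  intro σ a
  have h := weightedHomogeneousComponent_comm (fun _ => (2 : ℤ)) (fun _ => (2 : ℤ)) 0
    (rename σ : MvPolynomial (Fin q) ℂ →ₐ[ℂ] _).toLinearMap
    (fun m r => by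
      rw [add_zero, AlgHom.toLinearMap_apply, rename_eq_aeval]
      exact isWeightedHomogeneous_aeval_monomial _ (fun i => isWeightedHomogeneous_X _ _ _) m r)
    (n + ∑ i, SVwt (a i)) (c (a ∘ σ))
  simp only [AlgHom.toLinearMap_apply, add_zero, hc σ a, map_smul] at h
  rw [SVproj, SVproj, h]
  simp only [Function.comp_apply, Equiv.sum_comp σ fun i => SVwt (a i)]

lemma SVskip_sum {q : ℕ} (f : Fin (q + 2) → ℤ) {i j : Fin (q + 2)} (h : (i : ℕ) < (j : ℕ)) :
    ∑ l, f l = f i + f j + ∑ k, f (SVskip i j k) := by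
  have hi : (i : ℕ) ≤ q := by omega
  rw [Fin.sum_univ_succAbove f j,
    Fin.sum_univ_succAbove _ (⟨min (i : ℕ) q, Nat.lt_succ_of_le (Nat.min_le_right _ _)⟩ :
      Fin (q + 1))]
  have : j.succAbove (⟨min (i : ℕ) q, Nat.lt_succ_of_le (Nat.min_le_right _ _)⟩ : Fin (q + 1))
      = i := by
    rw [Fin.succAbove_of_castSucc_lt]
    · ext; simp [hi]
    · rw [Fin.lt_def]; simp [hi, h]
  rw [this]
  simp only [SVskip]
  ring

lemma SVdTerm_proj {q : ℕ} (n : ℤ) (c : SVRaw (q + 1)) (a : Fin (q + 2) → SVGen)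
    {i j : Fin (q + 2)} (hij : (i : ℕ) < (j : ℕ)) :
    SVdTerm (SVproj n c) a i j =
      weightedHomogeneousComponent (fun _ => (2 : ℤ)) (n + ∑ i, SVwt (a i)) (SVdTerm c a i j) := by
  obtain ⟨x, hx⟩ : ∃ x, x = SVbrk (a i) (a j) := ⟨_, rfl⟩
  have hw : (x.2.1 = 0 ∧ x.2.2 = 0) ∨ SVwt x.1 + 2 = SVwt (a i) + SVwt (a j) := by
    subst hx
    cases a i <;> cases a j <;> simp [SVbrk, SVwt]
  simp only [SVdTerm, ← hx]
  rcases hw with ⟨h1, h2⟩ | hw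
  · simp [h1, h2]
  have hX : ∀ k : Fin (q + 2),
      IsWeightedHomogeneous (fun _ => (2 : ℤ)) (X k : MvPolynomial (Fin (q + 2)) ℂ) 2 :=
    fun k => isWeightedHomogeneous_X ℂ _ k
  have h := weightedHomogeneousComponent_comm (fun _ => (2 : ℤ)) (fun _ => (2 : ℤ)) 2
    ((LinearMap.mulLeft ℂ (C x.2.2 * X i - C x.2.1 * (X i + X j))).comp
      (aeval (Fin.cons (X i + X j) fun k => X (SVskip i j k)) :
        MvPolynomial (Fin (q + 1)) ℂ →ₐ[ℂ] _).toLinearMap)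
    (fun m r => by
      rw [LinearMap.comp_apply, AlgHom.toLinearMap_apply, LinearMap.mulLeft_apply,
        add_comm (Finsupp.weight _ m)]
      refine IsWeightedHomogeneous.mul ?_ (isWeightedHomogeneous_aeval_monomial _ ?_ m r)
      · exact ((hX i).C_mul _).sub (((hX i).add (hX j)).C_mul _)
      · intro k
        refine Fin.cases ?_ (fun k => ?_) k
        · simpa using (hX i).add (hX j)
        · simpa using hX _)
    (n + ∑ k, SVwt ((Fin.cons x.1 fun k => a (SVskip i j k) : Fin (q + 1) → SVGen) k))
    (c (Fin.cons x.1 fun k => a (SVskip i j k)))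
  simp only [LinearMap.comp_apply, AlgHom.toLinearMap_apply, LinearMap.mulLeft_apply] at h
  rw [map_smul, SVproj, ← h]
  congr 3
  rw [Fin.sum_univ_succ, SVskip_sum (fun k => SVwt (a k)) hij, ← hw]
  simp only [Fin.cons_zero, Fin.cons_succ]
  ring

lemma SVd_proj {q : ℕ} (n : ℤ) (c : SVRaw (q + 1)) :
    SVd (SVproj n c) = SVproj n (SVd c) := by
  funext a
  simp only [SVd, SVproj, map_sum]
  refine Finset.sum_congr rfl fun i _ => Finset.sum_congr rfl fun j _ => ?_
  split_ifs with h
  · exact SVdTerm_proj n c a h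
  · simp

instance : Fintype SVGen := ⟨{L, Y, M}, by rintro (_ | _ | _) <;> decide⟩

lemma exists_sum_SVproj {q : ℕ} (c : SVRaw q) : ∃ S : Finset ℤ, ∑ n ∈ S, SVproj n c = c := by
  refine ⟨Finset.univ.biUnion fun a => (c a).support.image fun m =>
    Finsupp.weight (fun _ => (2 : ℤ)) m - ∑ i, SVwt (a i), ?_⟩
  funext a
  ext m
  simp only [Finset.sum_apply, SVproj, coeff_sum, coeff_weightedHomogeneousComponent]
  simp only [← sub_eq_iff_eq_add, Finset.sum_ite_eq]
  split_ifs with h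
  · rfl
  · by_contra h0
    exact h (Finset.mem_biUnion.2 ⟨a, Finset.mem_univ _, Finset.mem_image.2
      ⟨m, by simpa [eq_comm] using h0, rfl⟩⟩)

lemma eq_vec_four {α : Type*} (f : Fin 4 → α) : f = ![f 0, f 1, f 2, f 3] := by
  funext k
  fin_cases k <;> rfl

lemma SVCochain_eval {q : ℕ} {c : SVRaw q} (hc : c ∈ SVCochain q) (σ : Equiv.Perm (Fin q))
    (a : Fin q → SVGen) (x : Fin q → ℂ) :
    eval (x ∘ σ) (c (a ∘ σ)) = ((Equiv.Perm.sign σ : ℤ) : ℂ) * eval x (c a) := by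
  have h := congrArg (eval x) (hc σ a)
  rwa [eval_rename, smul_eval] at h

/-- The factor `c₂x - c₁(x+y)` produced by the bracket `[a_x b] = (c₁∂ + c₂x)g`. -/
noncomputable def SVfac (a b : SVGen) (x y : ℂ) : ℂ :=
  (SVbrk a b).2.2 * x - (SVbrk a b).2.1 * (x + y)

/-- The value of `SVdTerm c a i j` at the point `x`. -/
noncomputable def SVdTermEval {q : ℕ} (c : SVRaw (q + 1)) (a : Fin (q + 2) → SVGen)
    (x : Fin (q + 2) → ℂ) (i j : Fin (q + 2)) : ℂ :=
  (-1) ^ ((i : ℕ) + (j : ℕ)) * (SVfac (a i) (a j) (x i) (x j) *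
    eval (Fin.cons (x i + x j) fun k => x (SVskip i j k))
      (c (Fin.cons (SVbrk (a i) (a j)).1 fun k => a (SVskip i j k))))

lemma eval_SVdTerm {q : ℕ} (c : SVRaw (q + 1)) (a : Fin (q + 2) → SVGen) (i j : Fin (q + 2))
    (x : Fin (q + 2) → ℂ) : eval x (SVdTerm c a i j) = SVdTermEval c a x i j := by
  have h : (eval x).comp (aeval (Fin.cons (X i + X j) fun k => X (SVskip i j k)) :
        MvPolynomial (Fin (q + 1)) ℂ →ₐ[ℂ] _).toRingHom =
      eval (Fin.cons (x i + x j) fun k => x (SVskip i j k)) := by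
    ext k
    · simp
    · refine Fin.cases ?_ (fun k => ?_) k <;> simp
  rw [SVdTerm, SVdTermEval, smul_eval, map_mul, ← h]
  simp [SVfac]

lemma eval_SVd {q : ℕ} (c : SVRaw (q + 1)) (a : Fin (q + 2) → SVGen) (x : Fin (q + 2) → ℂ) :
    eval x (SVd c a) = ∑ i : Fin (q + 2), ∑ j : Fin (q + 2),
      if (i : ℕ) < (j : ℕ) then SVdTermEval c a x i j else 0 := by
  simp only [SVd, map_sum, apply_ite (eval x), map_zero, eval_SVdTerm]

lemma eval_SVd_three (c : SVRaw 3) (a₀ a₁ a₂ a₃ : SVGen) (x₀ x₁ x₂ x₃ : ℂ) :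
    eval ![x₀, x₁, x₂, x₃] (SVd c ![a₀, a₁, a₂, a₃]) =
      - (SVfac a₀ a₁ x₀ x₁ * eval ![x₀ + x₁, x₂, x₃] (c ![(SVbrk a₀ a₁).1, a₂, a₃]))
      + SVfac a₀ a₂ x₀ x₂ * eval ![x₀ + x₂, x₁, x₃] (c ![(SVbrk a₀ a₂).1, a₁, a₃])
      - SVfac a₀ a₃ x₀ x₃ * eval ![x₀ + x₃, x₁, x₂] (c ![(SVbrk a₀ a₃).1, a₁, a₂])
      - SVfac a₁ a₂ x₁ x₂ * eval ![x₁ + x₂, x₀, x₃] (c ![(SVbrk a₁ a₂).1, a₀, a₃])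
      + SVfac a₁ a₃ x₁ x₃ * eval ![x₁ + x₃, x₀, x₂] (c ![(SVbrk a₁ a₃).1, a₀, a₂])
      - SVfac a₂ a₃ x₂ x₃ * eval ![x₂ + x₃, x₀, x₁] (c ![(SVbrk a₂ a₃).1, a₀, a₁]) := by
  have key : ∀ {α : Type} (f : Fin 4 → α) (i j : Fin 4) (k l : Fin 4) (y : α),
      SVskip i j (0 : Fin 2) = k → SVskip i j (1 : Fin 2) = l →
      (Fin.cons y fun m : Fin 2 => f (SVskip i j m) : Fin 3 → α) = ![y, f k, f l] := by
    intro α f i j k l y h0 h1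
    funext m
    fin_cases m
    · rfl
    · exact congrArg f h0
    · exact congrArg f h1
  have hd : eval ![x₀, x₁, x₂, x₃] (SVd c ![a₀, a₁, a₂, a₃]) = ∑ i : Fin 4, ∑ j : Fin 4,
      if (i : ℕ) < (j : ℕ) then SVdTermEval c ![a₀, a₁, a₂, a₃] ![x₀, x₁, x₂, x₃] i j else 0 :=
    eval_SVd c ![a₀, a₁, a₂, a₃] ![x₀, x₁, x₂, x₃]
  rw [hd]
  simp only [Fin.sum_univ_four, SVdTermEval]
  simp only [key _ 0 1 2 3 _ rfl rfl, key _ 0 2 1 3 _ rfl rfl, key _ 0 3 1 2 _ rfl rfl,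
    key _ 1 2 0 3 _ rfl rfl, key _ 1 3 0 2 _ rfl rfl, key _ 2 3 0 1 _ rfl rfl]
  simp
  ring

lemma eval_SVd_four (c : SVRaw 4) (a₀ a₁ a₂ a₃ a₄ : SVGen) (x₀ x₁ x₂ x₃ x₄ : ℂ) :
    eval ![x₀, x₁, x₂, x₃, x₄] (SVd c ![a₀, a₁, a₂, a₃, a₄]) =
      - (SVfac a₀ a₁ x₀ x₁ * eval ![x₀ + x₁, x₂, x₃, x₄] (c ![(SVbrk a₀ a₁).1, a₂, a₃, a₄]))
      + SVfac a₀ a₂ x₀ x₂ * eval ![x₀ + x₂, x₁, x₃, x₄] (c ![(SVbrk a₀ a₂).1, a₁, a₃, a₄])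
      - SVfac a₀ a₃ x₀ x₃ * eval ![x₀ + x₃, x₁, x₂, x₄] (c ![(SVbrk a₀ a₃).1, a₁, a₂, a₄])
      + SVfac a₀ a₄ x₀ x₄ * eval ![x₀ + x₄, x₁, x₂, x₃] (c ![(SVbrk a₀ a₄).1, a₁, a₂, a₃])
      - SVfac a₁ a₂ x₁ x₂ * eval ![x₁ + x₂, x₀, x₃, x₄] (c ![(SVbrk a₁ a₂).1, a₀, a₃, a₄])
      + SVfac a₁ a₃ x₁ x₃ * eval ![x₁ + x₃, x₀, x₂, x₄] (c ![(SVbrk a₁ a₃).1, a₀, a₂, a₄])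
      - SVfac a₁ a₄ x₁ x₄ * eval ![x₁ + x₄, x₀, x₂, x₃] (c ![(SVbrk a₁ a₄).1, a₀, a₂, a₃])
      - SVfac a₂ a₃ x₂ x₃ * eval ![x₂ + x₃, x₀, x₁, x₄] (c ![(SVbrk a₂ a₃).1, a₀, a₁, a₄])
      + SVfac a₂ a₄ x₂ x₄ * eval ![x₂ + x₄, x₀, x₁, x₃] (c ![(SVbrk a₂ a₄).1, a₀, a₁, a₃])
      - SVfac a₃ a₄ x₃ x₄ * eval ![x₃ + x₄, x₀, x₁, x₂] (c ![(SVbrk a₃ a₄).1, a₀, a₁, a₂]) := by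
  have key : ∀ {α : Type} (f : Fin 5 → α) (i j : Fin 5) (k l n : Fin 5) (y : α),
      SVskip i j (0 : Fin 3) = k → SVskip i j (1 : Fin 3) = l → SVskip i j (2 : Fin 3) = n →
      (Fin.cons y fun m : Fin 3 => f (SVskip i j m) : Fin 4 → α) = ![y, f k, f l, f n] := by
    intro α f i j k l n y h0 h1 h2
    funext m
    fin_cases m
    · rfl
    · exact congrArg f h0
    · exact congrArg f h1
    · exact congrArg f h2
  have hd : eval ![x₀, x₁, x₂, x₃, x₄] (SVd c ![a₀, a₁, a₂, a₃, a₄]) = ∑ i : Fin 5, ∑ j : Fin 5,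
      if (i : ℕ) < (j : ℕ) then SVdTermEval c ![a₀, a₁, a₂, a₃, a₄] ![x₀, x₁, x₂, x₃, x₄] i j else 0 :=
    eval_SVd c ![a₀, a₁, a₂, a₃, a₄] ![x₀, x₁, x₂, x₃, x₄]
  rw [hd]
  simp only [Fin.sum_univ_five, SVdTermEval]
  simp only [key _ 0 1 2 3 4 _ rfl rfl rfl, key _ 0 2 1 3 4 _ rfl rfl rfl,
    key _ 0 3 1 2 4 _ rfl rfl rfl, key _ 0 4 1 2 3 _ rfl rfl rfl,
    key _ 1 2 0 3 4 _ rfl rfl rfl, key _ 1 3 0 2 4 _ rfl rfl rfl,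
    key _ 1 4 0 2 3 _ rfl rfl rfl, key _ 2 3 0 1 4 _ rfl rfl rfl,
    key _ 2 4 0 1 3 _ rfl rfl rfl, key _ 3 4 0 1 2 _ rfl rfl rfl]
  simp
  ring

lemma eval_SVtau_three (c : SVRaw 4) (a₀ a₁ a₂ : SVGen) (x₀ x₁ x₂ : ℂ) :
    eval ![x₀, x₁, x₂] (SVtau c ![a₀, a₁, a₂]) =
      -eval ![x₀, x₁, x₂, 0] (pderiv 3 (c ![a₀, a₁, a₂, L])) := by
  have h : (eval ![x₀, x₁, x₂]).comp (aeval (Fin.snoc (fun i : Fin 3 => X i) 0) :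
        MvPolynomial (Fin 4) ℂ →ₐ[ℂ] MvPolynomial (Fin 3) ℂ).toRingHom =
      eval ![x₀, x₁, x₂, 0] := by
    ext k
    · simp
    · fin_cases k <;> simp [Fin.snoc]
      rfl
  have ha : (Fin.snoc ![a₀, a₁, a₂] L : Fin 4 → SVGen) = ![a₀, a₁, a₂, L] := by
    funext k
    fin_cases k <;> rfl
  rw [SVtau, smul_eval, ← h]
  have h3 : Fin.last 3 = 3 := rfl
  simp only [ha, h3, RingHom.comp_apply]
  norm_num

lemma SVtau_cochain {c : SVRaw 4} (hc : c ∈ SVCochain 4) : SVtau c ∈ SVCochain 3 := by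
  intro σ a
  obtain ⟨σ', hs, hl, hσ⟩ : ∃ σ' : Equiv.Perm (Fin 4), Equiv.Perm.sign σ' = Equiv.Perm.sign σ ∧
      σ' 3 = 3 ∧ ∀ i : Fin 3, σ' i.castSucc = (σ i).castSucc := by
    revert σ
    decide
  have hcomp : ∀ {α : Type} (f : Fin 3 → α) (y : α),
      (![f (σ 0), f (σ 1), f (σ 2), y] : Fin 4 → α) = ![f 0, f 1, f 2, y] ∘ σ' := by
    intro α f y
    have hf : ∀ i : Fin 3, f i = (![f 0, f 1, f 2, y] : Fin 4 → α) i.castSucc := by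
      intro i
      fin_cases i <;> rfl
    funext k
    fin_cases k
    · simpa [hσ] using (hf (σ 0)).trans (congrArg _ (hσ 0).symm)
    · simpa [hσ] using (hf (σ 1)).trans (congrArg _ (hσ 1).symm)
    · simpa [hσ] using (hf (σ 2)).trans (congrArg _ (hσ 2).symm)
    · simp [hl]
  have hvec : ∀ {α : Type} (f : Fin 3 → α), f = ![f 0, f 1, f 2] := by
    intro α f
    funext k
    fin_cases k <;> rfl
  apply MvPolynomial.funext
  intro x
  rw [eval_rename, smul_eval]
  rw [hvec (x ∘ σ), hvec (a ∘ σ), hvec x, hvec a]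
  simp only [Function.comp_apply, eval_SVtau_three]
  rw [← hvec x, ← hvec a, hcomp x, hcomp a, ← eval_rename, ← pderiv_rename σ'.injective, hc σ', hl,
    hs, Derivation.map_smul, smul_eval]
  ring

lemma hasDerivAt_eval {n : ℕ} (p : MvPolynomial (Fin n) ℂ) (f : ℂ → Fin n → ℂ) (f' : Fin n → ℂ)
    (t : ℂ) (hf : ∀ i, HasDerivAt (fun s => f s i) (f' i) t) :
    HasDerivAt (fun s => eval (f s) p) (∑ i, f' i * eval (f t) (pderiv i p)) t := by
  induction p using MvPolynomial.induction_on with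
  | C r => simpa using hasDerivAt_const t r
  | add p q hp hq =>
    simp only [map_add, mul_add, Finset.sum_add_distrib]
    exact hp.add hq
  | mul_X p j hp =>
    simp only [map_mul, eval_X]
    refine (hp.mul (hf j)).congr_deriv ?_
    simp only [Derivation.leibniz, pderiv_X, smul_eq_mul, map_add, map_mul, eval_X, mul_add,
      Finset.sum_add_distrib, Pi.single_apply, apply_ite (eval _), map_zero, mul_ite,
      mul_one, mul_zero, Finset.sum_ite_eq, Finset.mem_univ, if_true,
      Finset.sum_mul]
    rw [add_comm]
    congr 1
    · ring
    · exact Finset.sum_congr rfl fun i _ => by ring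

lemma euler_identity {q : ℕ} {n : ℤ} {p : MvPolynomial (Fin q) ℂ}
    (hp : IsWeightedHomogeneous (fun _ => (2 : ℤ)) p n) (x : Fin q → ℂ) :
    2 * ∑ i, x i * eval x (pderiv i p) = n * eval x p := by
  by_cases h0 : p = 0
  · simp [h0]
  obtain ⟨m, hm⟩ := exists_coeff_ne_zero h0
  have hdeg : ∀ d : Fin q →₀ ℕ, Finsupp.weight (fun _ => (2 : ℤ)) d = 2 * (d.degree : ℤ) := by
    intro d
    simp [Finsupp.weight_apply, Finsupp.sum, Finsupp.degree_apply, Finset.mul_sum, mul_comm]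
  have hom : p.IsHomogeneous m.degree := by
    intro d hd
    have h1 := (hp hd).trans (hp hm).symm
    rw [hdeg, hdeg] at h1
    have h2 : Finsupp.weight 1 d = d.degree := by
      simp [Finsupp.weight_apply, Finsupp.sum, Finsupp.degree_apply]
    omega
  have hE := congrArg (eval x) hom.sum_X_mul_pderiv
  have hn : (n : ℂ) = 2 * (m.degree : ℂ) := by
    have h1 := hp hm
    rw [hdeg] at h1
    exact_mod_cast h1.symm
  simp only [map_sum, map_mul, eval_X, nsmul_eq_mul, map_natCast] at hE
  rw [hE, hn, mul_assoc]

lemma SVbrk_L_fst (a : SVGen) : (SVbrk a L).1 = a := by cases a <;> rfl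

lemma SVfac_L (a : SVGen) (x y : ℂ) : SVfac a L x y = x - SVwt a / 2 * y := by
  cases a <;> simp [SVfac, SVbrk, SVwt] <;> ring

lemma hasDerivAt_eval_last (p : MvPolynomial (Fin 4) ℂ) (y₀ y₁ y₂ : ℂ) :
    HasDerivAt (fun t => eval ![y₀, y₁, y₂, t] p) (eval ![y₀, y₁, y₂, 0] (pderiv 3 p)) 0 := by
  refine (hasDerivAt_eval p (fun t => ![y₀, y₁, y₂, t]) ![0, 0, 0, 1] 0 fun i => ?_).congr_deriv
    (by simp [Fin.sum_univ_four])
  fin_cases i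
  · exact hasDerivAt_const _ _
  · exact hasDerivAt_const _ _
  · exact hasDerivAt_const _ _
  · exact hasDerivAt_id _

lemma hasDerivAt_eval_update (p : MvPolynomial (Fin 4) ℂ) (x : Fin 4 → ℂ) (i : Fin 4) :
    HasDerivAt (fun t => eval (Function.update x i (x i + t)) p) (eval x (pderiv i p)) 0 := by
  refine (hasDerivAt_eval p (fun t => Function.update x i (x i + t)) (Pi.single i 1) 0
    fun j => ?_).congr_deriv (by simp [Pi.single_apply])
  by_cases h : j = i
  · subst h
    simpa using (hasDerivAt_id (0 : ℂ)).const_add (x j)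
  · simpa [h] using hasDerivAt_const (0 : ℂ) (x j)

lemma SVd_SVtau {n : ℤ} {c : SVRaw 4} (hc : c ∈ SVCochain 4) (hn : SVHomog n c)
    (hd : SVd c = 0) : SVd (SVtau c) = ((n : ℂ) / 2) • c := by
  funext a
  apply MvPolynomial.funext
  intro x
  rw [Pi.smul_apply, smul_eval]
  obtain ⟨a₀, a₁, a₂, a₃, rfl⟩ : ∃ a₀ a₁ a₂ a₃, a = ![a₀, a₁, a₂, a₃] := ⟨_, _, _, _, eq_vec_four a⟩
  obtain ⟨x₀, x₁, x₂, x₃, rfl⟩ : ∃ x₀ x₁ x₂ x₃, x = ![x₀, x₁, x₂, x₃] := ⟨_, _, _, _, eq_vec_four x⟩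
  have hcyc : ∀ (σ : Equiv.Perm (Fin 4)) (b₀ b₁ b₂ b₃ : SVGen) (y₀ y₁ y₂ y₃ : ℂ) (z : Fin 4 → ℂ),
      ![a₀, a₁, a₂, a₃] ∘ σ = ![b₀, b₁, b₂, b₃] → z ∘ σ = ![y₀, y₁, y₂, y₃] →
      eval ![y₀, y₁, y₂, y₃] (c ![b₀, b₁, b₂, b₃]) =
        ((Equiv.Perm.sign σ : ℤ) : ℂ) * eval z (c ![a₀, a₁, a₂, a₃]) := by
    intro σ b₀ b₁ b₂ b₃ y₀ y₁ y₂ y₃ z hb hz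
    rw [← hb, ← hz, SVCochain_eval hc]
  have h1 : ∀ t, eval ![x₁ + t, x₀, x₂, x₃] (c ![a₁, a₀, a₂, a₃]) =
      -eval (Function.update ![x₀, x₁, x₂, x₃] 1 (x₁ + t)) (c ![a₀, a₁, a₂, a₃]) := by
    intro t
    rw [hcyc (Equiv.swap 0 1) _ _ _ _ _ _ _ _
      (Function.update ![x₀, x₁, x₂, x₃] 1 (x₁ + t))]
    · simp [Equiv.Perm.sign_swap']
    · funext k; fin_cases k <;> rfl
    · funext k; fin_cases k <;> rfl
  have h2 : ∀ t, eval ![x₂ + t, x₀, x₁, x₃] (c ![a₂, a₀, a₁, a₃]) =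
      eval (Function.update ![x₀, x₁, x₂, x₃] 2 (x₂ + t)) (c ![a₀, a₁, a₂, a₃]) := by
    intro t
    rw [hcyc (Equiv.swap 0 1 * Equiv.swap 0 2) _ _ _ _ _ _ _ _
      (Function.update ![x₀, x₁, x₂, x₃] 2 (x₂ + t))]
    · simp [Equiv.Perm.sign_swap']
    · funext k; fin_cases k <;> rfl
    · funext k; fin_cases k <;> rfl
  have h3 : ∀ t, eval ![x₃ + t, x₀, x₁, x₂] (c ![a₃, a₀, a₁, a₂]) =
      -eval (Function.update ![x₀, x₁, x₂, x₃] 3 (x₃ + t)) (c ![a₀, a₁, a₂, a₃]) := by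
    intro t
    rw [hcyc (Equiv.swap 0 1 * Equiv.swap 0 2 * Equiv.swap 0 3) _ _ _ _ _ _ _ _
      (Function.update ![x₀, x₁, x₂, x₃] 3 (x₃ + t))]
    · simp [Equiv.Perm.sign_swap']
    · funext k; fin_cases k <;> rfl
    · funext k; fin_cases k <;> rfl
  have h0 : ∀ t, eval ![x₀ + t, x₁, x₂, x₃] (c ![a₀, a₁, a₂, a₃]) =
      eval (Function.update ![x₀, x₁, x₂, x₃] 0 (x₀ + t)) (c ![a₀, a₁, a₂, a₃]) := by
    intro t
    congr 2
    funext k; fin_cases k <;> rfl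
  have hG : ∀ t, eval ![x₀, x₁, x₂, x₃, t] (SVd c ![a₀, a₁, a₂, a₃, L]) = 0 := by
    intro t
    rw [hd]
    simp
  simp only [eval_SVd_four, SVbrk_L_fst, SVfac_L, h0, h1, h2, h3] at hG
  have hlin : ∀ (y : ℂ) (w : ℤ), HasDerivAt (fun t : ℂ => y - w / 2 * t) (-(w / 2)) 0 := by
    intro y w
    simpa using ((hasDerivAt_id (0 : ℂ)).const_mul ((w : ℂ) / 2)).const_sub y
  have hP := fun (y₀ y₁ y₂ : ℂ) (b₀ b₁ b₂ : SVGen) =>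
    hasDerivAt_eval_last (c ![b₀, b₁, b₂, L]) y₀ y₁ y₂
  have hU := hasDerivAt_eval_update (c ![a₀, a₁, a₂, a₃]) ![x₀, x₁, x₂, x₃]
  have hE := euler_identity (hn ![a₀, a₁, a₂, a₃]) ![x₀, x₁, x₂, x₃]
  have hD := ((((((((((hP (x₀ + x₁) x₂ x₃ (SVbrk a₀ a₁).1 a₂ a₃).const_mul
    (SVfac a₀ a₁ x₀ x₁)).neg.add
    ((hP (x₀ + x₂) x₁ x₃ (SVbrk a₀ a₂).1 a₁ a₃).const_mul (SVfac a₀ a₂ x₀ x₂))).sub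
    ((hP (x₀ + x₃) x₁ x₂ (SVbrk a₀ a₃).1 a₁ a₂).const_mul (SVfac a₀ a₃ x₀ x₃))).add
    ((hlin x₀ (SVwt a₀)).mul (hU 0))).sub
    ((hP (x₁ + x₂) x₀ x₃ (SVbrk a₁ a₂).1 a₀ a₃).const_mul (SVfac a₁ a₂ x₁ x₂))).add
    ((hP (x₁ + x₃) x₀ x₂ (SVbrk a₁ a₃).1 a₀ a₂).const_mul (SVfac a₁ a₃ x₁ x₃))).sub
    ((hlin x₁ (SVwt a₁)).mul (hU 1).neg)).sub
    ((hP (x₂ + x₃) x₀ x₁ (SVbrk a₂ a₃).1 a₀ a₁).const_mul (SVfac a₂ a₃ x₂ x₃))).add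
    ((hlin x₂ (SVwt a₂)).mul (hU 2))).sub
    ((hlin x₃ (SVwt a₃)).mul (hU 3).neg)
  have hZ := hD.unique ((hasDerivAt_const (0 : ℂ) (0 : ℂ)).congr_of_eventuallyEq
    (Filter.Eventually.of_forall hG))
  rw [eval_SVd_three]
  simp only [eval_SVtau_three]
  simp only [Fin.sum_univ_four] at hE
  simp only [Pi.neg_apply, add_zero, Function.update_eq_self] at hZ
  simp at hE hZ
  linear_combination -hZ + hE / 2

/-- The wedge product of the functionals dual to `(b i).1` with exponent `(b i).2`. -/
noncomputable def SVwedge {q : ℕ} (b : Fin q → SVGen × ℕ) : SVRaw q := fun a =>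
  Matrix.det (Matrix.of fun i j => if a j = (b i).1 then X j ^ (b i).2 else 0)

/-- The coefficient of a cochain at generators `(b i).1` and exponents `(b i).2`. -/
noncomputable def SVcoef {q : ℕ} (c : SVRaw q) (b : Fin q → SVGen × ℕ) : ℂ :=
  coeff (Finsupp.equivFunOnFinite.symm fun i => (b i).2) (c fun i => (b i).1)

lemma SVwedge_cochain {q : ℕ} (b : Fin q → SVGen × ℕ) : SVwedge b ∈ SVCochain q := by
  intro σ a
  rw [SVwedge, SVwedge, AlgHom.map_det]
  have h : (rename σ : MvPolynomial (Fin q) ℂ →ₐ[ℂ] _).mapMatrix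
      (Matrix.of fun i j => if (a ∘ σ) j = (b i).1 then X j ^ (b i).2 else 0) =
      (Matrix.of fun i j => if a j = (b i).1 then X j ^ (b i).2 else 0).submatrix id σ := by
    ext1 i j
    simp [apply_ite (rename σ)]
  rw [h, Matrix.det_permute', smul_eq_C_mul, map_intCast]

lemma eval_SVwedge {q : ℕ} (b : Fin q → SVGen × ℕ) (a : Fin q → SVGen) (x : Fin q → ℂ) :
    eval x (SVwedge b a) =
      Matrix.det (Matrix.of fun i j => if a j = (b i).1 then x j ^ (b i).2 else 0) := by
  rw [SVwedge, RingHom.map_det]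
  congr 1
  ext i j
  simp [apply_ite (eval x)]

lemma SVcoef_wedge {q : ℕ} (b b' : Fin q → SVGen × ℕ) :
    SVcoef (SVwedge b) b' =
      ((Matrix.det (Matrix.of fun i j => if b' j = b i then (1 : ℤ) else 0) : ℤ) : ℂ) := by
  rw [SVcoef, SVwedge, Matrix.det_apply', Matrix.det_apply', coeff_sum, Int.cast_sum]
  refine Finset.sum_congr rfl fun σ _ => ?_
  rw [← map_intCast (C : ℂ →+* MvPolynomial (Fin q) ℂ), coeff_C_mul, Int.cast_mul]
  congr 1
  simp only [Matrix.of_apply, Finset.prod_ite_zero, Finset.prod_const_one, Finset.mem_univ,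
    true_imp_iff]
  have hX : ∏ i : Fin q, (X i : MvPolynomial (Fin q) ℂ) ^ (b (σ i)).2 =
      monomial (Finsupp.equivFunOnFinite.symm fun i => (b (σ i)).2) 1 := by
    rw [monomial_eq, Finsupp.prod_fintype _ _ (by simp)]
    simp
  rw [hX]
  by_cases h : ∀ i, b' i = b (σ i)
  · simp [h]
  · rw [if_neg h]
    split_ifs with h1
    · rw [coeff_monomial, if_neg, Int.cast_zero]
      intro h2
      refine h fun i => Prod.ext (h1 i) ?_
      exact (congrFun (Finsupp.equivFunOnFinite.symm.injective h2) i).symm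
    · simp

lemma SVcoef_perm {q : ℕ} {c : SVRaw q} (hc : c ∈ SVCochain q) (σ : Equiv.Perm (Fin q))
    (b : Fin q → SVGen × ℕ) : SVcoef c (b ∘ σ) = ((Equiv.Perm.sign σ : ℤ) : ℂ) * SVcoef c b := by
  have h := congrArg (coeff (Finsupp.equivFunOnFinite.symm fun i => (b i).2))
    (hc σ fun i => (b i).1)
  rw [coeff_smul, smul_eq_mul] at h
  rw [SVcoef, SVcoef, ← h, ← coeff_rename_mapDomain σ σ.injective]
  congr 1
  ext i
  obtain ⟨j, rfl⟩ := σ.surjective i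
  rw [Finsupp.mapDomain_apply σ.injective]
  simp

lemma SVcoef_eq_zero_of_eq {q : ℕ} {c : SVRaw q} (hc : c ∈ SVCochain q) {b : Fin q → SVGen × ℕ}
    {i j : Fin q} (hij : i ≠ j) (hb : b i = b j) : SVcoef c b = 0 := by
  have h := SVcoef_perm hc (Equiv.swap i j) b
  have hs : b ∘ Equiv.swap i j = b := by
    funext k
    rcases eq_or_ne k i with rfl | hi
    · simp [hb]
    rcases eq_or_ne k j with rfl | hj
    · simp [hb]
    · simp [Equiv.swap_apply_of_ne_of_ne hi hj]
  rw [hs, Equiv.Perm.sign_swap hij] at h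
  norm_num at h
  linear_combination h / 2

lemma ext_SVcoef {q : ℕ} {c c' : SVRaw q} (h : ∀ b, SVcoef c b = SVcoef c' b) : c = c' := by
  funext a
  ext m
  simpa [SVcoef] using h fun i => (a i, m i)

lemma SVcoef_eq_zero_of_weight {q : ℕ} {n : ℤ} {c : SVRaw q} (hc : SVHomog n c)
    {b : Fin q → SVGen × ℕ} (hb : ∑ i, 2 * ((b i).2 : ℤ) ≠ n + ∑ i, SVwt (b i).1) :
    SVcoef c b = 0 := by
  by_contra h
  refine hb (Eq.trans ?_ (hc _ h))
  rw [Finsupp.weight_apply, Finsupp.sum_fintype _ _ (by simp)]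
  simp [mul_comm]

lemma SVwedge_homog {q : ℕ} {n : ℤ} {b : Fin q → SVGen × ℕ}
    (hb : ∑ i, 2 * ((b i).2 : ℤ) = n + ∑ i, SVwt (b i).1) : SVHomog n (SVwedge b) := by
  intro a m hm
  have h : SVcoef (SVwedge b) (fun i => (a i, m i)) ≠ 0 := by simpa [SVcoef] using hm
  rw [SVcoef_wedge, Int.cast_ne_zero, Matrix.det_apply'] at h
  obtain ⟨σ, -, hσ⟩ := Finset.exists_ne_zero_of_sum_ne_zero h
  have hσ' : ∀ i, (a i, m i) = b (σ i) := fun i => by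
    by_contra hi
    exact right_ne_zero_of_mul hσ (Finset.prod_eq_zero (Finset.mem_univ i) (by simp [hi]))
  rw [Finsupp.weight_apply, Finsupp.sum_fintype _ _ (by simp)]
  rw [← Equiv.sum_comp σ, ← Equiv.sum_comp σ (fun i => SVwt (b i).1)] at hb
  simp only [← hσ'] at hb
  rw [← hb]
  simp [mul_comm]

/-- The strictly increasing quadruples of basis functionals of total weight zero. -/
def SVbasis : Fin 7 → Fin 4 → SVGen × ℕ := ![
  ![(L, 0), (L, 1), (L, 2), (M, 0)],
  ![(L, 0), (L, 1), (Y, 0), (Y, 2)],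
  ![(L, 0), (L, 1), (M, 0), (M, 1)],
  ![(L, 0), (L, 2), (Y, 0), (Y, 1)],
  ![(L, 0), (Y, 0), (Y, 1), (M, 1)],
  ![(L, 0), (Y, 0), (Y, 2), (M, 0)],
  ![(L, 1), (Y, 0), (Y, 1), (M, 0)]]

/-- Position of a generator in the order `L < Y < M`. -/
def SVidx : SVGen → ℕ
  | L => 0
  | Y => 1
  | M => 2

lemma SVwt_eq (g : SVGen) : SVwt g = 2 - SVidx g := by cases g <;> rfl

lemma SVidx_injective : Function.Injective SVidx := by decide

lemma exists_perm_eq_SVbasis {b : Fin 4 → SVGen × ℕ}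
    (hb : ∑ i, 2 * ((b i).2 : ℤ) = ∑ i, SVwt (b i).1) (hinj : Function.Injective b) :
    ∃ (σ : Equiv.Perm (Fin 4)) (k : Fin 7), b ∘ σ = SVbasis k := by
  have hle : ∀ i, (b i).2 ≤ 4 := by
    simp only [SVwt_eq, Fin.sum_univ_four] at hb
    intro i
    fin_cases i <;> simp <;> omega
  obtain ⟨κ, hκ⟩ : ∃ κ : Fin 4 → ℕ, κ = fun i => 5 * SVidx (b i).1 + (b i).2 := ⟨_, rfl⟩
  have hκinj : Function.Injective κ := by
    intro i j h
    have hi := hle i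
    have hj := hle j
    simp only [hκ] at h
    exact hinj (Prod.ext (SVidx_injective (by omega)) (by omega))
  have hmono : StrictMono (κ ∘ Tuple.sort κ) :=
    (Tuple.monotone_sort κ).strictMono_of_injective (hκinj.comp (Tuple.sort κ).injective)
  refine ⟨Tuple.sort κ, ?_⟩
  generalize Tuple.sort κ = σ at hmono
  rw [← Equiv.sum_comp σ, ← Equiv.sum_comp σ (fun i => SVwt (b i).1)] at hb
  have h01 : κ (σ 0) < κ (σ 1) := hmono (by decide)
  have h12 : κ (σ 1) < κ (σ 2) := hmono (by decide)
  have h23 : κ (σ 2) < κ (σ 3) := hmono (by decide)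
  have hle' := fun i => hle (σ i)
  have hfin : ∀ p : Fin 4 → SVGen × ℕ, p 0 = b (σ 0) → p 1 = b (σ 1) → p 2 = b (σ 2) →
      p 3 = b (σ 3) → b ∘ σ = p := by
    intro p h0 h1 h2 h3
    funext i
    fin_cases i
    · exact h0.symm
    · exact h1.symm
    · exact h2.symm
    · exact h3.symm
  have h0 := hle' 0
  have h1 := hle' 1
  have h2 := hle' 2
  have h3 := hle' 3
  simp only [hκ, Fin.sum_univ_four] at *
  generalize b (σ 0) = b₀ at *
  generalize b (σ 1) = b₁ at *
  generalize b (σ 2) = b₂ at *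
  generalize b (σ 3) = b₃ at *
  obtain ⟨g₀, n₀⟩ := b₀
  obtain ⟨g₁, n₁⟩ := b₁
  obtain ⟨g₂, n₂⟩ := b₂
  obtain ⟨g₃, n₃⟩ := b₃
  suffices h : ∃ k, SVbasis k = ![(g₀, n₀), (g₁, n₁), (g₂, n₂), (g₃, n₃)] by
    obtain ⟨k, hk⟩ := h
    exact ⟨k, hfin _ (by rw [hk]; rfl) (by rw [hk]; rfl) (by rw [hk]; rfl) (by rw [hk]; rfl)⟩
  clear hfin hmono hle' hle hκinj hκ hinj
  cases g₀ <;> cases g₁ <;> simp only [SVwt, SVidx] at * <;> try omega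
  all_goals cases g₂ <;> cases g₃ <;> dsimp only at * <;> try omega
  · obtain ⟨rfl, rfl, rfl, rfl⟩ : n₀ = 0 ∧ n₁ = 1 ∧ n₂ = 2 ∧ n₃ = 0 := by omega
    exact ⟨0, rfl⟩
  · obtain ⟨rfl, rfl, rfl, rfl⟩ | ⟨rfl, rfl, rfl, rfl⟩ :
        (n₀ = 0 ∧ n₁ = 1 ∧ n₂ = 0 ∧ n₃ = 2) ∨ (n₀ = 0 ∧ n₁ = 2 ∧ n₂ = 0 ∧ n₃ = 1) := by omega
    · exact ⟨1, rfl⟩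
    · exact ⟨3, rfl⟩
  · obtain ⟨rfl, rfl, rfl, rfl⟩ : n₀ = 0 ∧ n₁ = 1 ∧ n₂ = 0 ∧ n₃ = 1 := by omega
    exact ⟨2, rfl⟩
  · obtain ⟨rfl, rfl, rfl, rfl⟩ | ⟨rfl, rfl, rfl, rfl⟩ | ⟨rfl, rfl, rfl, rfl⟩ :
        (n₀ = 0 ∧ n₁ = 0 ∧ n₂ = 1 ∧ n₃ = 1) ∨ (n₀ = 0 ∧ n₁ = 0 ∧ n₂ = 2 ∧ n₃ = 0) ∨
          (n₀ = 1 ∧ n₁ = 0 ∧ n₂ = 1 ∧ n₃ = 0) := by omega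
    · exact ⟨4, rfl⟩
    · exact ⟨5, rfl⟩
    · exact ⟨6, rfl⟩

lemma SVcoef_wedge_basis (k l : Fin 7) :
    SVcoef (SVwedge (SVbasis k)) (SVbasis l) = if k = l then 1 else 0 := by
  have h : ∀ k l : Fin 7, Matrix.det (Matrix.of fun i j =>
      if SVbasis l j = SVbasis k i then (1 : ℤ) else 0) = if k = l then 1 else 0 := by
    decide +kernel
  rw [SVcoef_wedge, h]
  split_ifs <;> simp

lemma SVbasis_weight (k : Fin 7) :
    ∑ i, 2 * ((SVbasis k i).2 : ℤ) = ∑ i, SVwt (SVbasis k i).1 := by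
  revert k
  decide

/-- `SVcoef` at a fixed argument, as a linear functional. -/
noncomputable def SVcoefLin {q : ℕ} (b : Fin q → SVGen × ℕ) : SVRaw q →ₗ[ℂ] ℂ where
  toFun c := SVcoef c b
  map_add' c c' := by simp [SVcoef]
  map_smul' r c := by simp [SVcoef]

lemma eq_sum_SVbasis {c : SVRaw 4} (hc : c ∈ SVCochain 4) (hn : SVHomog 0 c) :
    c = ∑ k, SVcoef c (SVbasis k) • SVwedge (SVbasis k) := by
  have hs : ∑ k, SVcoef c (SVbasis k) • SVwedge (SVbasis k) ∈ SVCochain 4 :=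
    Submodule.sum_mem _ fun k _ => Submodule.smul_mem _ _ (SVwedge_cochain _)
  have hsb : ∀ b, SVcoef (∑ k, SVcoef c (SVbasis k) • SVwedge (SVbasis k)) b =
      ∑ k, SVcoef c (SVbasis k) * SVcoef (SVwedge (SVbasis k)) b := fun b => by
    have h := map_sum (SVcoefLin b) (fun k => SVcoef c (SVbasis k) • SVwedge (SVbasis k))
      Finset.univ
    simp only [map_smul] at h
    exact h
  refine ext_SVcoef fun b => ?_
  by_cases hb : ∑ i, 2 * ((b i).2 : ℤ) = ∑ i, SVwt (b i).1
  · by_cases hinj : Function.Injective b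
    · obtain ⟨σ, k, hk⟩ := exists_perm_eq_SVbasis hb hinj
      have hbk : b = SVbasis k ∘ σ.symm := by
        rw [← hk, Function.comp_assoc, Equiv.self_comp_symm, Function.comp_id]
      rw [hbk, SVcoef_perm hc, SVcoef_perm hs, hsb]
      simp [SVcoef_wedge_basis]
    · simp only [Function.Injective, not_forall] at hinj
      obtain ⟨i, j, hij, hne⟩ := hinj
      rw [SVcoef_eq_zero_of_eq hc hne hij, SVcoef_eq_zero_of_eq hs hne hij]
  · have hb' : ∑ i, 2 * ((b i).2 : ℤ) ≠ 0 + ∑ i, SVwt (b i).1 := by rwa [zero_add]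
    rw [SVcoef_eq_zero_of_weight hn hb', hsb]
    refine (Finset.sum_eq_zero fun k _ => ?_).symm
    rw [SVcoef_eq_zero_of_weight (SVwedge_homog (n := 0) ?_) hb', mul_zero]
    rw [zero_add, SVbasis_weight]

/-- The value at `x` of the functional dual to the generator `p.1` with exponent `p.2`. -/
noncomputable def SVdual (p : SVGen × ℕ) (a : SVGen) (x : ℂ) : ℂ :=
  if a = p.1 then x ^ p.2 else 0

lemma eval_SVwedge_three (p₀ p₁ p₂ : SVGen × ℕ) (a₀ a₁ a₂ : SVGen) (x₀ x₁ x₂ : ℂ) :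
    eval ![x₀, x₁, x₂] (SVwedge ![p₀, p₁, p₂] ![a₀, a₁, a₂]) =
      SVdual p₀ a₀ x₀ * (SVdual p₁ a₁ x₁ * SVdual p₂ a₂ x₂ - SVdual p₁ a₂ x₂ * SVdual p₂ a₁ x₁)
      - SVdual p₀ a₁ x₁ * (SVdual p₁ a₀ x₀ * SVdual p₂ a₂ x₂ - SVdual p₁ a₂ x₂ * SVdual p₂ a₀ x₀)
      + SVdual p₀ a₂ x₂ * (SVdual p₁ a₀ x₀ * SVdual p₂ a₁ x₁ - SVdual p₁ a₁ x₁ * SVdual p₂ a₀ x₀) := by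
  refine (eval_SVwedge _ _ _).trans ((Matrix.det_fin_three _).trans ?_)
  change SVdual p₀ a₀ x₀ * SVdual p₁ a₁ x₁ * SVdual p₂ a₂ x₂
    - SVdual p₀ a₀ x₀ * SVdual p₁ a₂ x₂ * SVdual p₂ a₁ x₁
    - SVdual p₀ a₁ x₁ * SVdual p₁ a₀ x₀ * SVdual p₂ a₂ x₂
    + SVdual p₀ a₁ x₁ * SVdual p₁ a₂ x₂ * SVdual p₂ a₀ x₀
    + SVdual p₀ a₂ x₂ * SVdual p₁ a₀ x₀ * SVdual p₂ a₁ x₁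
    - SVdual p₀ a₂ x₂ * SVdual p₁ a₁ x₁ * SVdual p₂ a₀ x₀ = _
  ring

lemma eval_SVwedge_four (p₀ p₁ p₂ p₃ : SVGen × ℕ) (a₀ a₁ a₂ a₃ : SVGen) (x₀ x₁ x₂ x₃ : ℂ) :
    eval ![x₀, x₁, x₂, x₃] (SVwedge ![p₀, p₁, p₂, p₃] ![a₀, a₁, a₂, a₃]) =
      SVdual p₀ a₀ x₀ * eval ![x₁, x₂, x₃] (SVwedge ![p₁, p₂, p₃] ![a₁, a₂, a₃])
      - SVdual p₀ a₁ x₁ * eval ![x₀, x₂, x₃] (SVwedge ![p₁, p₂, p₃] ![a₀, a₂, a₃])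
      + SVdual p₀ a₂ x₂ * eval ![x₀, x₁, x₃] (SVwedge ![p₁, p₂, p₃] ![a₀, a₁, a₃])
      - SVdual p₀ a₃ x₃ * eval ![x₀, x₁, x₂] (SVwedge ![p₁, p₂, p₃] ![a₀, a₁, a₂]) := by
  have hs : ∀ (α : Type) (u₀ u₁ u₂ u₃ : α) (k : Fin 4),
      (fun j => ![u₀, u₁, u₂, u₃] (k.succAbove j)) =
        ![![u₁, u₂, u₃], ![u₀, u₂, u₃], ![u₀, u₁, u₃], ![u₀, u₁, u₂]] k := by
    intro α u₀ u₁ u₂ u₃ k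
    funext j
    fin_cases k <;> fin_cases j <;> rfl
  have hm : ∀ k : Fin 4, Matrix.det ((Matrix.of fun i j =>
      SVdual (![p₀, p₁, p₂, p₃] i) (![a₀, a₁, a₂, a₃] j) (![x₀, x₁, x₂, x₃] j)).submatrix
        Fin.succ k.succAbove) =
      eval (fun j => ![x₀, x₁, x₂, x₃] (k.succAbove j))
        (SVwedge ![p₁, p₂, p₃] fun j => ![a₀, a₁, a₂, a₃] (k.succAbove j)) :=
    fun k => (eval_SVwedge _ _ _).symm
  refine (eval_SVwedge _ _ _).trans ((Matrix.det_succ_row_zero _).trans ?_)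
  refine (Finset.sum_congr rfl fun k _ => congrArg _ (hm k)).trans ?_
  change ∑ k : Fin 4, (-1 : ℂ) ^ (k : ℕ) *
    SVdual p₀ (![a₀, a₁, a₂, a₃] k) (![x₀, x₁, x₂, x₃] k) * _ = _
  simp only [hs, Fin.sum_univ_four]
  simp
  ring

lemma ext_eval_four {c c' : SVRaw 4}
    (h : ∀ a₀ a₁ a₂ a₃ x₀ x₁ x₂ x₃, eval ![x₀, x₁, x₂, x₃] (c ![a₀, a₁, a₂, a₃]) =
      eval ![x₀, x₁, x₂, x₃] (c' ![a₀, a₁, a₂, a₃])) : c = c' := by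
  funext a
  refine MvPolynomial.funext fun x => ?_
  rw [eq_vec_four a, eq_vec_four x]
  exact h _ _ _ _ _ _ _ _

lemma SVd_SVwedge_L₀L₁M₁ : SVd (SVwedge ![(L, 0), (L, 1), (M, 1)]) = SVwedge (SVbasis 1) := by
  refine ext_eval_four fun a₀ a₁ a₂ a₃ x₀ x₁ x₂ x₃ => ?_
  change _ = eval _ (SVwedge ![(L, 0), (L, 1), (Y, 0), (Y, 2)] _)
  rw [eval_SVd_three, eval_SVwedge_four]
  cases a₀ <;> cases a₁ <;> cases a₂ <;> cases a₃ <;>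
    simp only [eval_SVwedge_three, SVdual, SVbrk, SVfac, reduceCtorEq, if_true, if_false,
      mul_zero, zero_mul, sub_zero, add_zero, zero_add, zero_sub, neg_zero] <;> ring

lemma SVd_SVwedge_L₀L₂M₀ : SVd (SVwedge ![(L, 0), (L, 2), (M, 0)]) = SVwedge (SVbasis 3) := by
  refine ext_eval_four fun a₀ a₁ a₂ a₃ x₀ x₁ x₂ x₃ => ?_
  change _ = eval _ (SVwedge ![(L, 0), (L, 2), (Y, 0), (Y, 1)] _)
  rw [eval_SVd_three, eval_SVwedge_four]
  cases a₀ <;> cases a₁ <;> cases a₂ <;> cases a₃ <;>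
    simp only [eval_SVwedge_three, SVdual, SVbrk, SVfac, reduceCtorEq, if_true, if_false,
      mul_zero, zero_mul, sub_zero, add_zero, zero_add, zero_sub, neg_zero] <;> ring

lemma SVd_SVwedge_L₀M₀M₁ : SVd (SVwedge ![(L, 0), (M, 0), (M, 1)]) =
    SVwedge (SVbasis 5) - SVwedge (SVbasis 4) := by
  refine ext_eval_four fun a₀ a₁ a₂ a₃ x₀ x₁ x₂ x₃ => ?_
  change _ = eval _ (SVwedge ![(L, 0), (Y, 0), (Y, 2), (M, 0)] _ -
    SVwedge ![(L, 0), (Y, 0), (Y, 1), (M, 1)] _)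
  rw [map_sub, eval_SVd_three, eval_SVwedge_four, eval_SVwedge_four]
  cases a₀ <;> cases a₁ <;> cases a₂ <;> cases a₃ <;>
    simp only [eval_SVwedge_three, SVdual, SVbrk, SVfac, reduceCtorEq, if_true, if_false,
      mul_zero, zero_mul, sub_zero, add_zero, zero_add, zero_sub, neg_zero] <;> ring

lemma SVd_SVwedge_Y₀Y₁M₀ : SVd (SVwedge ![(Y, 0), (Y, 1), (M, 0)]) =
    SVwedge (SVbasis 4) + SVwedge (SVbasis 5) := by
  refine ext_eval_four fun a₀ a₁ a₂ a₃ x₀ x₁ x₂ x₃ => ?_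
  change _ = eval _ (SVwedge ![(L, 0), (Y, 0), (Y, 1), (M, 1)] _ +
    SVwedge ![(L, 0), (Y, 0), (Y, 2), (M, 0)] _)
  rw [map_add, eval_SVd_three, eval_SVwedge_four, eval_SVwedge_four]
  cases a₀ <;> cases a₁ <;> cases a₂ <;> cases a₃ <;>
    simp only [eval_SVwedge_three, SVdual, SVbrk, SVfac, reduceCtorEq, if_true, if_false,
      mul_zero, zero_mul, sub_zero, add_zero, zero_add, zero_sub, neg_zero] <;> ring

lemma eval_sum_SVbasis (F : Fin 7 → ℂ) (a : Fin 4 → SVGen) (x : Fin 4 → ℂ) :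
    eval x ((∑ k, F k • SVwedge (SVbasis k)) a) =
      F 0 * eval x (SVwedge ![(L, 0), (L, 1), (L, 2), (M, 0)] a)
      + F 1 * eval x (SVwedge ![(L, 0), (L, 1), (Y, 0), (Y, 2)] a)
      + F 2 * eval x (SVwedge ![(L, 0), (L, 1), (M, 0), (M, 1)] a)
      + F 3 * eval x (SVwedge ![(L, 0), (L, 2), (Y, 0), (Y, 1)] a)
      + F 4 * eval x (SVwedge ![(L, 0), (Y, 0), (Y, 1), (M, 1)] a)
      + F 5 * eval x (SVwedge ![(L, 0), (Y, 0), (Y, 2), (M, 0)] a)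
      + F 6 * eval x (SVwedge ![(L, 1), (Y, 0), (Y, 1), (M, 0)] a) := by
  rw [Fin.sum_univ_seven]
  simp only [Pi.add_apply, Pi.smul_apply, map_add, smul_eval]
  rfl

lemma coef_eq_zero_of_SVd_eq_zero {F : Fin 7 → ℂ}
    (hF : SVd (∑ k, F k • SVwedge (SVbasis k)) = 0) : F 0 = 0 ∧ F 2 = 0 ∧ F 6 = 0 := by
  have h : ∀ a x, eval x (SVd (∑ k, F k • SVwedge (SVbasis k)) a) = 0 := fun a x => by
    rw [hF, Pi.zero_apply, map_zero]
  have h₁ := h ![L, L, L, Y, Y] ![0, 1, 2, 0, 1]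
  have h₂ := h ![L, L, Y, Y, M] ![-1, 1, 0, 1, 0]
  have h₃ := h ![L, L, Y, Y, M] ![-1, 1, -1, 1, 1]
  rw [eval_SVd_four] at h₁ h₂ h₃
  simp only [eval_sum_SVbasis, eval_SVwedge_four, eval_SVwedge_three, SVdual, SVbrk, SVfac,
    reduceCtorEq, if_true, if_false, mul_zero, zero_mul, sub_zero, add_zero, zero_add, zero_sub]
    at h₁ h₂ h₃
  norm_num at h₁ h₂ h₃
  refine ⟨?_, ?_, ?_⟩ <;> grind

lemma mem_SVcoboundaries_of_homog_zero {c : SVRaw 4} (hc : c ∈ SVCochain 4) (hn : SVHomog 0 c)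
    (hd : SVd c = 0) : c ∈ SVcoboundaries 4 := by
  obtain ⟨F, hF⟩ : ∃ F : Fin 7 → ℂ, c = ∑ k, F k • SVwedge (SVbasis k) :=
    ⟨_, eq_sum_SVbasis hc hn⟩
  rw [hF] at hd
  obtain ⟨h0, h2, h6⟩ := coef_eq_zero_of_SVd_eq_zero hd
  have hmem : ∀ b, SVd (SVwedge b) ∈ SVcoboundaries 4 := fun b =>
    Submodule.mem_map_of_mem (f := SVdLin 3) (SVwedge_cochain b)
  have h₁ := hmem ![(L, 0), (L, 1), (M, 1)]
  have h₃ := hmem ![(L, 0), (L, 2), (M, 0)]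
  have h₄ := hmem ![(L, 0), (M, 0), (M, 1)]
  have h₅ := hmem ![(Y, 0), (Y, 1), (M, 0)]
  rw [SVd_SVwedge_L₀L₁M₁] at h₁
  rw [SVd_SVwedge_L₀L₂M₀] at h₃
  rw [SVd_SVwedge_L₀M₀M₁] at h₄
  rw [SVd_SVwedge_Y₀Y₁M₀] at h₅
  have hc' : c = F 1 • SVwedge (SVbasis 1) + F 3 • SVwedge (SVbasis 3)
      + ((F 5 - F 4) / 2) • (SVwedge (SVbasis 5) - SVwedge (SVbasis 4))
      + ((F 4 + F 5) / 2) • (SVwedge (SVbasis 4) + SVwedge (SVbasis 5)) := by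
    rw [hF, Fin.sum_univ_seven, h0, h2, h6]
    module
  rw [hc']
  exact add_mem (add_mem (add_mem (Submodule.smul_mem _ _ h₁) (Submodule.smul_mem _ _ h₃))
    (Submodule.smul_mem _ _ h₄)) (Submodule.smul_mem _ _ h₅)

lemma mem_SVcoboundaries_of_homog {n : ℤ} {c : SVRaw 4} (hc : c ∈ SVCochain 4)
    (hn : SVHomog n c) (hd : SVd c = 0) : c ∈ SVcoboundaries 4 := by
  rcases eq_or_ne n 0 with rfl | h0
  · exact mem_SVcoboundaries_of_homog_zero hc hn hd
  · have h0' : (n : ℂ) ≠ 0 := Int.cast_ne_zero.mpr h0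
    refine ⟨(2 / (n : ℂ)) • SVtau c, Submodule.smul_mem _ _ (SVtau_cochain hc), ?_⟩
    rw [map_smul]
    change (2 / (n : ℂ)) • SVd (SVtau c) = c
    rw [SVd_SVtau hc hn hd, smul_smul]
    rw [div_mul_div_cancel₀' two_ne_zero, div_self h0', one_smul]

lemma SVcocycles_four_le : SVcocycles 4 ≤ SVcoboundaries 4 := by
  rintro c ⟨hc, hd⟩
  have hd' : SVd c = 0 := hd
  obtain ⟨S, hS⟩ := exists_sum_SVproj c
  rw [← hS]
  refine Submodule.sum_mem _ fun n _ =>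
    mem_SVcoboundaries_of_homog (SVproj_cochain n hc) (SVproj_homog n c) ?_
  rw [SVd_proj, hd']
  funext a
  simp [SVproj]

/-- `H̃⁴(SV,ℂ) = 0`: every `4`-cocycle is a `4`-coboundary. -/
theorem statement8 :
    SVcocycles 4 ≤ SVcoboundaries 4 ∧ Subsingleton (SVbasicH 4) := by
  refine ⟨SVcocycles_four_le, ?_⟩
  have h : Submodule.comap (SVcocycles 4).subtype (SVcoboundaries 4) = ⊤ :=
    Submodule.comap_subtype_eq_top.mpr SVcocycles_four_le
  exact Submodule.Quotient.subsingleton_iff.mpr h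

end SVCA
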